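/- Let σ be a spectral function, β ∈ (0,1), u_β ∈ (0,1) the solution of ∫_0^{u_β} σ(u) du = β, and σ_β the spectral function with σ_β(u) = 0 for u < u_β and σ_β(u) = σ(u)/(1−β) for u ≥ u_β. Let Y be an integrable random variable with ∫_0^1 σ_β(u)·|F_Y^{-1}(u)| du < ∞ and assume there exists a random variable U₀ on (Ω, Σ, P), uniformly distributed on [0,1], with Y = F_Y^{-1}(U₀) almost surely. Then R_{σ_β}(Y) = sup{ E[Y·σ_β(U)] : U is a random variable on (Ω, Σ, P) uniformly distributed on [0,1] such that Y·σ_β(U) is integrable }. -/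

import Mathlib

open MeasureTheory Set

/-- Cumulative distribution function `F_Y(x) = P(Y ≤ x)`. -/
noncomputable def cdfR {Ω : Type*} [MeasurableSpace Ω] (P : Measure Ω) (Y : Ω → ℝ)
    (x : ℝ) : ℝ :=
  (P {ω | Y ω ≤ x}).toReal

/-- Quantile function `F_Y⁻¹(u) = inf {x : F_Y(x) ≥ u}`. -/
noncomputable def quantR {Ω : Type*} [MeasurableSpace Ω] (P : Measure Ω) (Y : Ω → ℝ)
    (u : ℝ) : ℝ :=
  sInf {x : ℝ | u ≤ cdfR P Y x}

/-- Spectral risk measure `R_σ(Y) = ∫_0^1 σ(u) F_Y⁻¹(u) du`. -/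
noncomputable def specR {Ω : Type*} [MeasurableSpace Ω] (P : Measure Ω) (σ : ℝ → ℝ)
    (Y : Ω → ℝ) : ℝ :=
  ∫ u in (0 : ℝ)..1, σ u * quantR P Y u

/-- `U` is uniformly distributed on `[0,1]` under `P`. -/
def IsUniform01 {Ω : Type*} [MeasurableSpace Ω] (P : Measure Ω) (U : Ω → ℝ) : Prop :=
  Measure.map U P = volume.restrict (Set.Icc (0 : ℝ) 1)


lemma cdfR_eq_aux {Ω : Type*} [MeasurableSpace Ω] (P : Measure Ω) [IsProbabilityMeasure P]
    (Y : Ω → ℝ) (hY : AEMeasurable Y P) (x : ℝ) :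
    cdfR P Y x = ProbabilityTheory.cdf (P.map Y) x := by
  have := Measure.isProbabilityMeasure_map hY
  rw [ProbabilityTheory.cdf_eq_real, Measure.real, Measure.map_apply_of_aemeasurable hY measurableSet_Iic]
  rfl

lemma quantR_mono_aux {Ω : Type*} [MeasurableSpace Ω] (P : Measure Ω) [IsProbabilityMeasure P]
    (Y : Ω → ℝ) (hY : AEMeasurable Y P) : MonotoneOn (quantR P Y) (Ioo 0 1) := by
  intro a ha b hb hab
  have := Measure.isProbabilityMeasure_map hY
  unfold quantR
  apply csInf_le_csInf
  · have h := ProbabilityTheory.tendsto_cdf_atBot (P.map Y)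
    obtain ⟨x, hx⟩ := (h.eventually (gt_mem_nhds ha.1)).exists
    refine ⟨x, fun y hy => ?_⟩
    by_contra hlt
    push Not at hlt
    have h1 := ProbabilityTheory.monotone_cdf (P.map Y) hlt.le
    have h2 : a ≤ cdfR P Y y := hy
    rw [cdfR_eq_aux P Y hY] at h2
    linarith
  · have h := ProbabilityTheory.tendsto_cdf_atTop (P.map Y)
    obtain ⟨x, hx⟩ := (h.eventually (lt_mem_nhds hb.2)).exists
    refine ⟨x, ?_⟩
    show b ≤ cdfR P Y x
    rw [cdfR_eq_aux P Y hY]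
    exact hx.le
  · intro x hx
    exact hab.trans hx

lemma layer_aux {Ω : Type*} [MeasurableSpace Ω] (P : Measure Ω) [IsProbabilityMeasure P]
    (Y f : Ω → ℝ) (hY : Integrable Y P) (hf : Measurable f) (hf0 : ∀ ω, 0 ≤ f ω)
    (hYf : Integrable (fun ω => Y ω * f ω) P) :
    Integrable (fun t => ∫ ω, Y ω * (if t < f ω then 1 else 0) ∂P) (volume.restrict (Ioi 0)) ∧
    ∫ ω, Y ω * f ω ∂P = ∫ t in Ioi (0:ℝ), ∫ ω, Y ω * (if t < f ω then 1 else 0) ∂P := by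
  have key : ∀ (ω : Ω) (c : ℝ), (fun t : ℝ => c * (if t < f ω then (1:ℝ) else 0))
      = (Iio (f ω)).indicator (fun _ => c) := by
    intro ω c
    ext t
    by_cases h : t < f ω <;> simp [h]
  have hset : ∀ ω, (Iio (f ω)) ∩ Ioi (0:ℝ) = Ioo 0 (f ω) := by
    intro ω; ext; simp [and_comm]
  have hint : ∀ (ω : Ω) (c : ℝ), ∫ t in Ioi (0:ℝ), c * (if t < f ω then (1:ℝ) else 0) = c * f ω := by
    intro ω c
    rw [key, integral_indicator measurableSet_Iio, Measure.restrict_restrict measurableSet_Iio,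
      hset]
    simp [hf0 ω, mul_comm]
  have hI : Integrable (fun p : Ω × ℝ => Y p.1 * (if p.2 < f p.1 then (1:ℝ) else 0))
      (P.prod (volume.restrict (Ioi 0))) := by
    have hm : AEStronglyMeasurable (fun p : Ω × ℝ => Y p.1 * (if p.2 < f p.1 then (1:ℝ) else 0))
      (P.prod (volume.restrict (Ioi 0))) := by
      apply AEStronglyMeasurable.mul
      · exact hY.aestronglyMeasurable.comp_fst
      · apply Measurable.aestronglyMeasurable
        exact Measurable.ite (measurableSet_lt measurable_snd (hf.comp measurable_fst))
          measurable_const measurable_const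
    rw [integrable_prod_iff hm]
    constructor
    · refine Filter.Eventually.of_forall fun ω => ?_
      simp only []
      rw [key, integrable_indicator_iff measurableSet_Iio, IntegrableOn,
        Measure.restrict_restrict measurableSet_Iio, hset]
      simp
    · have : (fun ω => ∫ t in Ioi (0:ℝ), ‖Y ω * (if t < f ω then (1:ℝ) else 0)‖)
          = fun ω => ‖Y ω * f ω‖ := by
        ext ω
        rw [norm_mul, Real.norm_of_nonneg (hf0 ω), ← hint]
        congr 1
        ext t
        rw [norm_mul]
        congr 1
        split_ifs <;> simp
      simp only []
      rw [this]
      exact hYf.norm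
  refine ⟨hI.integral_prod_right, ?_⟩
  rw [← integral_integral_swap (f := fun ω t => Y ω * (if t < f ω then (1:ℝ) else 0)) hI]
  simp only [hint]

lemma layer_le_aux {Ω : Type*} [MeasurableSpace Ω] (P : Measure Ω) [IsProbabilityMeasure P]
    (Y f g : Ω → ℝ) (hY : Integrable Y P) (hf : Measurable f) (hf0 : ∀ ω, 0 ≤ f ω)
    (hg : Measurable g) (hg0 : ∀ ω, 0 ≤ g ω)
    (hYf : Integrable (fun ω => Y ω * f ω) P) (hYg : Integrable (fun ω => Y ω * g ω) P)
    (h : ∀ t : ℝ, 0 < t → ∫ ω, Y ω * (if t < f ω then 1 else 0) ∂P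
      ≤ ∫ ω, Y ω * (if t < g ω then 1 else 0) ∂P) :
    ∫ ω, Y ω * f ω ∂P ≤ ∫ ω, Y ω * g ω ∂P := by
  obtain ⟨a1, a2⟩ := layer_aux P Y f hY hf hf0 hYf
  obtain ⟨b1, b2⟩ := layer_aux P Y g hY hg hg0 hYg
  rw [a2, b2]
  exact setIntegral_mono_on a1 b1 measurableSet_Ioi (fun t ht => h t ht)

lemma rearr_aux {Ω : Type*} [MeasurableSpace Ω] (P : Measure Ω) [IsProbabilityMeasure P]
    (Y U V : Ω → ℝ) (q : ℝ → ℝ) (S : Set ℝ) (hS : MeasurableSet S) (hS1 : S ⊆ Ioo 0 1)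
    (hup : ∀ x ∈ S, ∀ y ∈ Ioo (0:ℝ) 1, x ≤ y → y ∈ S)
    (hq : MonotoneOn q (Ioo 0 1))
    (hY : Integrable Y P) (hU : Measurable U) (hV : Measurable V)
    (hUV : P.map U = P.map V) (hU1 : ∀ᵐ ω ∂P, U ω ∈ Ioo (0:ℝ) 1)
    (hV1 : ∀ᵐ ω ∂P, V ω ∈ Ioo (0:ℝ) 1) (hYV : ∀ᵐ ω ∂P, Y ω = q (V ω)) :
    ∫ ω, (U ⁻¹' S).indicator Y ω ∂P ≤ ∫ ω, (V ⁻¹' S).indicator Y ω ∂P := by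
  have hUS := hU hS
  have hVS := hV hS
  have hP : P (U ⁻¹' S) = P (V ⁻¹' S) := by
    rw [← Measure.map_apply hU hS, hUV, Measure.map_apply hV hS]
  have hsep : ((Ioo (0:ℝ) 1 \ S).Nonempty ∧ S.Nonempty) ∨ S = ∅ ∨ Ioo (0:ℝ) 1 ⊆ S := by
    rcases S.eq_empty_or_nonempty with h | h
    · exact Or.inr (Or.inl h)
    · rcases (Ioo (0:ℝ) 1 \ S).eq_empty_or_nonempty with h' | h'
      · exact Or.inr (Or.inr (sdiff_eq_empty.1 h'))
      · exact Or.inl ⟨h', h⟩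
  rcases hsep with ⟨h1, h2⟩ | h | h
  · obtain ⟨c, hc1, hc2⟩ := exists_between_of_forall_le (h1.image q) (h2.image q) (by
      rintro _ ⟨x, hx, rfl⟩ _ ⟨y, hy, rfl⟩
      apply hq hx.1 (hS1 hy)
      by_contra hlt
      push Not at hlt
      exact hx.2 (hup y hy x hx.1 hlt.le))
    have e1 : ∀ A : Set Ω, MeasurableSet A → ∫ ω, A.indicator (fun ω => Y ω - c) ω ∂P
        = ∫ ω, A.indicator Y ω ∂P - P.real A * c := by
      intro A hA
      rw [integral_indicator hA, integral_indicator hA,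
        integral_sub hY.integrableOn (integrable_const c).integrableOn]
      simp
    have hYc : Integrable (fun ω => Y ω - c) P := hY.sub (integrable_const c)
    have h3 : ∫ ω, (U ⁻¹' S).indicator (fun ω => Y ω - c) ω ∂P
        ≤ ∫ ω, (V ⁻¹' S).indicator (fun ω => Y ω - c) ω ∂P := by
      apply integral_mono_ae (hYc.indicator hUS) (hYc.indicator hVS)
      filter_upwards [hV1, hYV] with ω hω1 hω2
      by_cases hVω : V ω ∈ S
      · have : c ≤ Y ω := by rw [hω2]; exact hc2 ⟨_, hVω, rfl⟩
        by_cases hUω : U ω ∈ S <;> simp [indicator, hVω, hUω, this]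
      · have : Y ω ≤ c := by rw [hω2]; exact hc1 ⟨_, ⟨hω1, hVω⟩, rfl⟩
        by_cases hUω : U ω ∈ S <;> simp [indicator, hVω, hUω, this]
    rw [e1 _ hUS, e1 _ hVS] at h3
    have : P.real (U ⁻¹' S) = P.real (V ⁻¹' S) := by simp [Measure.real, hP]
    rw [this] at h3
    linarith
  · simp [h]
  · apply le_of_eq
    apply integral_congr_ae
    filter_upwards [hV1, hU1] with ω a b
    simp [indicator, h a, h b]

lemma unif_aux {Ω : Type*} [MeasurableSpace Ω] (P : Measure Ω) [IsProbabilityMeasure P]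
    (U : Ω → ℝ) (hU : IsUniform01 P U) : AEMeasurable U P ∧ ∀ᵐ ω ∂P, U ω ∈ Ioo (0:ℝ) 1 := by
  have hU' : AEMeasurable U P := by
    by_contra h
    unfold IsUniform01 at hU
    rw [Measure.map_of_not_aemeasurable h] at hU
    have := congrArg (fun m => m univ) hU
    simp at this
  refine ⟨hU', ?_⟩
  have : ∀ᵐ x ∂(P.map U), x ∈ Ioo (0:ℝ) 1 := by
    rw [hU, ← Measure.restrict_congr_set (Ioo_ae_eq_Icc (μ := volume) (a := (0:ℝ)) (b := 1))]
    exact ae_restrict_mem measurableSet_Ioo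
  exact ae_of_ae_map hU' this

theorem stmt5 {Ω : Type*} [MeasurableSpace Ω] (P : Measure Ω) [IsProbabilityMeasure P]
    (σ : ℝ → ℝ) (hσ0 : ∀ u ∈ Set.Ico (0 : ℝ) 1, 0 ≤ σ u)
    (hσmono : MonotoneOn σ (Set.Ico (0 : ℝ) 1))
    (hσ1 : (∫ u in (0 : ℝ)..1, σ u) = 1)
    (β : ℝ) (hβ : β ∈ Set.Ioo (0 : ℝ) 1)
    (uβ : ℝ) (huβ : uβ ∈ Set.Ioo (0 : ℝ) 1) (huβeq : (∫ u in (0 : ℝ)..uβ, σ u) = β)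
    (σβ : ℝ → ℝ) (hσβ : ∀ u : ℝ, σβ u = if u < uβ then 0 else σ u / (1 - β))
    (Y : Ω → ℝ) (hYint : Integrable Y P)
    (hfin : IntervalIntegrable (fun u => σβ u * |quantR P Y u|) volume 0 1)
    (U₀ : Ω → ℝ) (hU₀ : IsUniform01 P U₀)
    (hYU₀ : ∀ᵐ ω ∂P, Y ω = quantR P Y (U₀ ω)) :
    specR P σβ Y =
      sSup {r : ℝ | ∃ U : Ω → ℝ, IsUniform01 P U ∧
        Integrable (fun ω => Y ω * σβ (U ω)) P ∧
        r = ∫ ω, Y ω * σβ (U ω) ∂P} := by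
  have hqm := quantR_mono_aux P Y hYint.aemeasurable
  set q := quantR P Y with hqdef
  have hβ1 : 0 < 1 - β := by linarith [hβ.2]
  have hs0 : ∀ u ∈ Ioo (0:ℝ) 1, 0 ≤ σβ u := by
    intro u hu
    rw [hσβ]
    split_ifs
    · exact le_rfl
    · exact div_nonneg (hσ0 u ⟨hu.1.le, hu.2⟩) hβ1.le
  have hsm : MonotoneOn σβ (Ioo 0 1) := by
    intro a ha b hb hab
    by_cases h : a < uβ
    · rw [hσβ a, if_pos h]
      exact hs0 b hb
    · have h' : ¬ b < uβ := by linarith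
      rw [hσβ a, hσβ b, if_neg h, if_neg h']
      exact div_le_div_of_nonneg_right (hσmono ⟨ha.1.le, ha.2⟩ ⟨hb.1.le, hb.2⟩ hab) hβ1.le
  set s : ℝ → ℝ := (Ioo (0:ℝ) 1).indicator σβ with hsdef
  have hsnn : ∀ u, 0 ≤ s u := fun u => indicator_nonneg hs0 u
  have hup : ∀ t : ℝ, 0 ≤ t → ∀ x ∈ {u | t < s u}, ∀ y ∈ Ioo (0:ℝ) 1, x ≤ y → y ∈ {u | t < s u} := by
    intro t ht x hx y hy hxy
    have hx1 : x ∈ Ioo (0:ℝ) 1 := by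
      by_contra h
      simp [hsdef, h] at hx
      linarith
    simp only [mem_setOf_eq, hsdef, indicator_of_mem hx1, indicator_of_mem hy] at hx ⊢
    exact hx.trans_le (hsm hx1 hy hxy)
  have hsub : ∀ t : ℝ, 0 ≤ t → {u | t < s u} ⊆ Ioo (0:ℝ) 1 := by
    intro t ht x hx
    by_contra h
    simp [hsdef, h] at hx
    linarith
  have hsmeas : Measurable s := by
    apply measurable_of_Ioi
    intro t
    rcases lt_or_ge t 0 with ht | ht
    · have : s ⁻¹' Ioi t = univ := by
        ext u; simpa using ht.trans_le (hsnn u)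
      rw [this]; exact MeasurableSet.univ
    · apply Set.OrdConnected.measurableSet
      refine ⟨fun x hx y hy z hz => ?_⟩
      have hx1 := hsub t ht hx
      have hy1 := hsub t ht hy
      exact hup t ht x hx z ⟨hx1.1.trans_le hz.1, hz.2.trans_lt hy1.2⟩ hz.1
  obtain ⟨hU0m, hU01⟩ := unif_aux P U₀ hU₀
  -- integrability and value at U₀
  have hqae : AEStronglyMeasurable q (volume.restrict (Ioo (0:ℝ) 1)) :=
    (aemeasurable_restrict_of_monotoneOn measurableSet_Ioo hqm).aestronglyMeasurable
  have hmap : P.map U₀ = volume.restrict (Ioo (0:ℝ) 1) := by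
    rw [hU₀, ← Measure.restrict_congr_set (Ioo_ae_eq_Icc (μ := volume) (a := (0:ℝ)) (b := 1))]
  have hsq : Integrable (fun u => s u * q u) (volume.restrict (Ioo (0:ℝ) 1)) := by
    rw [intervalIntegrable_iff_integrableOn_Ioo_of_le zero_le_one] at hfin
    refine Integrable.mono hfin (hsmeas.aestronglyMeasurable.mul hqae) ?_
    filter_upwards [ae_restrict_mem measurableSet_Ioo] with u hu
    simp [hsdef, hu]
  have hspec : specR P σβ Y = ∫ u in Ioo (0:ℝ) 1, s u * q u := by
    unfold specR
    rw [intervalIntegral.integral_of_le zero_le_one, integral_Ioc_eq_integral_Ioo]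
    apply setIntegral_congr_fun measurableSet_Ioo
    intro u hu
    simp [hsdef, hu, hqdef]
  have hae0 : (fun ω => Y ω * σβ (U₀ ω)) =ᵐ[P] fun ω => s (U₀ ω) * q (U₀ ω) := by
    filter_upwards [hU01, hYU₀] with ω h1 h2
    simp only [hsdef, indicator_of_mem h1]
    rw [← h2, mul_comm]
  rw [← hmap] at hsq hspec
  have hint0 : Integrable (fun ω => Y ω * σβ (U₀ ω)) P :=
    (hsq.comp_aemeasurable hU0m).congr hae0.symm
  have hval0 : specR P σβ Y = ∫ ω, Y ω * σβ (U₀ ω) ∂P := by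
    rw [integral_congr_ae hae0, hspec, integral_map hU0m hsq.aestronglyMeasurable]
  symm
  apply IsGreatest.csSup_eq
  refine ⟨⟨U₀, hU₀, hint0, hval0⟩, ?_⟩
  rintro r ⟨U, hU, hUint, rfl⟩
  obtain ⟨hUm, hU1⟩ := unif_aux P U hU
  rw [hval0]
  set V' := hU0m.mk U₀
  set U' := hUm.mk U
  have hV' : U₀ =ᵐ[P] V' := hU0m.ae_eq_mk
  have hU' : U =ᵐ[P] U' := hUm.ae_eq_mk
  have hV'm : Measurable V' := hU0m.measurable_mk
  have hU'm : Measurable U' := hUm.measurable_mk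
  have hV1 : ∀ᵐ ω ∂P, V' ω ∈ Ioo (0:ℝ) 1 := by
    filter_upwards [hV', hU01] with ω a b
    rwa [← a]
  have hU1' : ∀ᵐ ω ∂P, U' ω ∈ Ioo (0:ℝ) 1 := by
    filter_upwards [hU', hU1] with ω a b
    rwa [← a]
  have hYV : ∀ᵐ ω ∂P, Y ω = q (V' ω) := by
    filter_upwards [hV', hYU₀] with ω a b
    rwa [← a]
  have hmm : P.map U' = P.map V' := by
    rw [← Measure.map_congr hV', ← Measure.map_congr hU', hU₀, hU]
  have eV : (fun ω => Y ω * σβ (U₀ ω)) =ᵐ[P] fun ω => Y ω * s (V' ω) := by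
    filter_upwards [hV', hV1] with ω a b
    simp only [hsdef, indicator_of_mem b, a]
  have eU : (fun ω => Y ω * σβ (U ω)) =ᵐ[P] fun ω => Y ω * s (U' ω) := by
    filter_upwards [hU', hU1'] with ω a b
    simp only [hsdef, indicator_of_mem b, a]
  rw [integral_congr_ae eV, integral_congr_ae eU]
  apply layer_le_aux P Y (fun ω => s (U' ω)) (fun ω => s (V' ω)) hYint (hsmeas.comp hU'm)
    (fun _ => hsnn _) (hsmeas.comp hV'm) (fun _ => hsnn _) (hUint.congr eU) (hint0.congr eV)
  intro t ht
  have h := rearr_aux P Y U' V' q {u | t < s u} (measurableSet_lt measurable_const hsmeas)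
    (hsub t ht.le) (hup t ht.le) hqm hYint hU'm hV'm hmm hU1' hV1 hYV
  have e : ∀ W : Ω → ℝ, (fun ω => Y ω * (if t < s (W ω) then (1:ℝ) else 0))
      = (W ⁻¹' {u | t < s u}).indicator Y := by
    intro W
    ext ω
    by_cases h : t < s (W ω) <;> simp [indicator, h]
  rw [e U', e V']
  exact h
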